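/- arXiv:1811.08689 — 4 statements merged into one kernel-verified Lean document; each statement's English description precedes it below -/
import Mathlib

section
/- Let R be a Cu-semiring. The map ε_R: ⟦R,R⟧ → R defined by ε_R([ (f_λ)_λ ]) = sup_λ f_λ(1_R) is a well-defined generalized Cu-morphism, and it satisfies ε_R ∘ π_R = id_R, where π_R: R → ⟦R,R⟧ sends r to the class of the path of left multiplications by a path in (R,≪) with endpoint r. -/
/-! ### Abstract Cuntz semigroups: basic framework -/

/-- The way-below (compact containment) relation. -/
def WayBelow {S : Type*} [Preorder S] (a b : S) : Prop :=
  ∀ c : ℕ → S, Monotone c → ∀ s : S, IsLUB (Set.range c) s → b ≤ s → ∃ n, a ≤ c n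

/-- A `Cu`-semigroup (abstract Cuntz semigroup): a positively ordered monoid
satisfying the axioms (O1)-(O4). -/
class CuSemigroup (S : Type*) [AddCommMonoid S] [PartialOrder S] : Prop where
  add_le_add' : ∀ a b c d : S, a ≤ b → c ≤ d → a + c ≤ b + d
  zero_le' : ∀ a : S, (0 : S) ≤ a
  O1 : ∀ c : ℕ → S, Monotone c → ∃ s : S, IsLUB (Set.range c) s
  O2 : ∀ a : S, ∃ c : ℕ → S, (∀ n, WayBelow (c n) (c (n + 1))) ∧ IsLUB (Set.range c) a
  O3 : ∀ a' a b' b : S, WayBelow a' a → WayBelow b' b → WayBelow (a' + b') (a + b)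
  O4 : ∀ (c d : ℕ → S) (s t : S), Monotone c → Monotone d →
      IsLUB (Set.range c) s → IsLUB (Set.range d) t →
      IsLUB (Set.range (fun n => c n + d n)) (s + t)

section WayBelowBasic

variable {S : Type*} [Preorder S]

theorem WayBelow.le {a b : S} (h : WayBelow a b) : a ≤ b := by
  obtain ⟨n, hn⟩ := h (fun _ => b) monotone_const b
    (by rw [Set.range_const]; exact isLUB_singleton) le_rfl
  exact hn

theorem WayBelow.of_le_left {x a b : S} (hx : x ≤ a) (h : WayBelow a b) : WayBelow x b :=
  fun c hc s hs hbs => (h c hc s hs hbs).imp fun _ hn => hx.trans hn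

theorem WayBelow.of_le_right {a b y : S} (h : WayBelow a b) (hy : b ≤ y) : WayBelow a y :=
  fun c hc s hs hys => h c hc s hs (hy.trans hys)

end WayBelowBasic

theorem wayBelow_zero {S : Type*} [AddCommMonoid S] [PartialOrder S] [CuSemigroup S] {a : S} :
    WayBelow (0 : S) a :=
  fun _ _ _ _ _ => ⟨0, CuSemigroup.zero_le' _⟩

/-- Interpolation: if `a' ≪ a` then there is `x` with `a' ≪ x ≪ a`. -/
theorem exists_interpolate {S : Type*} [AddCommMonoid S] [PartialOrder S] [CuSemigroup S]
    {a' a : S} (h : WayBelow a' a) : ∃ x : S, WayBelow a' x ∧ WayBelow x a := by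
  obtain ⟨c, hc, hlub⟩ := CuSemigroup.O2 a
  have hmono : Monotone c := monotone_nat_of_le_succ fun n => (hc n).le
  obtain ⟨n, hn⟩ := h c hmono a hlub le_rfl
  exact ⟨c (n + 1), WayBelow.of_le_left hn (hc n),
    WayBelow.of_le_right (hc (n + 1)) (hlub.1 (Set.mem_range_self (n + 2)))⟩

/-! ### Generalized Cu-morphisms -/

/-- A generalized `Cu`-morphism: additive, monotone, zero preserving map which preserves
suprema of increasing sequences. -/
structure GenCuMor (S : Type*) (T : Type*) [AddCommMonoid S] [PartialOrder S]
    [AddCommMonoid T] [PartialOrder T] where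
  toFun : S → T
  map_zero' : toFun 0 = 0
  map_add' : ∀ a b : S, toFun (a + b) = toFun a + toFun b
  mono' : Monotone toFun
  map_sup' : ∀ (c : ℕ → S) (s : S), Monotone c → IsLUB (Set.range c) s →
    IsLUB (Set.range (fun n => toFun (c n))) (toFun s)

namespace GenCuMor

variable {S T P : Type*} [AddCommMonoid S] [PartialOrder S] [AddCommMonoid T] [PartialOrder T]
  [AddCommMonoid P] [PartialOrder P]

theorem ext' {f g : GenCuMor S T} (h : f.toFun = g.toFun) : f = g := by
  cases f; cases g; cases h; rfl

instance : PartialOrder (GenCuMor S T) where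
  le f g := ∀ a : S, f.toFun a ≤ g.toFun a
  le_refl f a := le_rfl
  le_trans f g h h1 h2 a := (h1 a).trans (h2 a)
  le_antisymm f g h1 h2 := ext' (funext fun a => le_antisymm (h1 a) (h2 a))

theorem le_def {f g : GenCuMor S T} : f ≤ g ↔ ∀ a : S, f.toFun a ≤ g.toFun a := Iff.rfl

instance : Zero (GenCuMor S T) where
  zero :=
    { toFun := fun _ => 0
      map_zero' := rfl
      map_add' := fun _ _ => (add_zero 0).symm
      mono' := monotone_const
      map_sup' := fun _ _ _ _ => by
        rw [Set.range_const]; exact isLUB_singleton }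

@[simp] theorem zero_toFun (a : S) : (0 : GenCuMor S T).toFun a = 0 := rfl

instance [CuSemigroup T] : Add (GenCuMor S T) where
  add f g :=
    { toFun := fun a => f.toFun a + g.toFun a
      map_zero' := by show f.toFun 0 + g.toFun 0 = 0; rw [f.map_zero', g.map_zero', add_zero]
      map_add' := by
        intro a b
        show f.toFun (a + b) + g.toFun (a + b) = _
        rw [f.map_add', g.map_add', add_add_add_comm]
      mono' := fun a b h => CuSemigroup.add_le_add' _ _ _ _ (f.mono' h) (g.mono' h)
      map_sup' := fun c s hc hs =>
        CuSemigroup.O4 (fun n => f.toFun (c n)) (fun n => g.toFun (c n)) _ _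
          (fun _ _ h => f.mono' (hc h)) (fun _ _ h => g.mono' (hc h))
          (f.map_sup' c s hc hs) (g.map_sup' c s hc hs) }

@[simp] theorem add_toFun [CuSemigroup T] (f g : GenCuMor S T) (a : S) :
    (f + g).toFun a = f.toFun a + g.toFun a := rfl

instance [CuSemigroup T] : AddCommMonoid (GenCuMor S T) where
  add := (· + ·)
  zero := 0
  add_assoc f g h := ext' (funext fun a => add_assoc (f.toFun a) (g.toFun a) (h.toFun a))
  zero_add f := ext' (funext fun a => zero_add (f.toFun a))
  add_zero f := ext' (funext fun a => add_zero (f.toFun a))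
  add_comm f g := ext' (funext fun a => add_comm (f.toFun a) (g.toFun a))
  nsmul := nsmulRec
  nsmul_zero := fun _ => rfl
  nsmul_succ := fun _ _ => rfl

/-- Composition of generalized Cu-morphisms. -/
def comp (g : GenCuMor T P) (f : GenCuMor S T) : GenCuMor S P where
  toFun := fun a => g.toFun (f.toFun a)
  map_zero' := by show g.toFun (f.toFun 0) = 0; rw [f.map_zero', g.map_zero']
  map_add' := fun a b => by
    show g.toFun (f.toFun (a + b)) = g.toFun (f.toFun a) + g.toFun (f.toFun b)
    rw [f.map_add', g.map_add']
  mono' := fun a b h => g.mono' (f.mono' h)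
  map_sup' := fun c s hc hs =>
    g.map_sup' (fun n => f.toFun (c n)) (f.toFun s) (fun _ _ h => f.mono' (hc h))
      (f.map_sup' c s hc hs)

@[simp] theorem comp_toFun (g : GenCuMor T P) (f : GenCuMor S T) (a : S) :
    (g.comp f).toFun a = g.toFun (f.toFun a) := rfl

/-- The identity generalized Cu-morphism. -/
def id (S : Type*) [AddCommMonoid S] [PartialOrder S] : GenCuMor S S where
  toFun := fun a => a
  map_zero' := rfl
  map_add' := fun _ _ => rfl
  mono' := monotone_id
  map_sup' := fun _ _ _ hs => hs

end GenCuMor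

/-- The auxiliary relation `f ≺ g` on generalized Cu-morphisms. -/
def Prec {S T : Type*} [AddCommMonoid S] [PartialOrder S] [AddCommMonoid T] [PartialOrder T]
    (f g : GenCuMor S T) : Prop :=
  ∀ a' a : S, WayBelow a' a → WayBelow (f.toFun a') (g.toFun a)

namespace Prec

variable {S T P : Type*} [AddCommMonoid S] [PartialOrder S] [AddCommMonoid T] [PartialOrder T]
  [AddCommMonoid P] [PartialOrder P]

theorem trans [CuSemigroup S] {f g h : GenCuMor S T} (h1 : Prec f g) (h2 : Prec g h) :
    Prec f h := by
  intro a' a ha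
  obtain ⟨x, hx1, hx2⟩ := exists_interpolate ha
  exact WayBelow.of_le_left (h1 a' x hx1).le (h2 x a hx2)

theorem add [CuSemigroup T] {f g f' g' : GenCuMor S T} (h : Prec f g) (h' : Prec f' g') :
    Prec (f + f') (g + g') :=
  fun a' a ha => CuSemigroup.O3 _ _ _ _ (h a' a ha) (h' a' a ha)

theorem comp {f f' : GenCuMor S T} {g g' : GenCuMor T P} (hf : Prec f f') (hg : Prec g g') :
    Prec (g.comp f) (g'.comp f') :=
  fun a' a ha => hg _ _ (hf a' a ha)

end Prec

/-! ### Paths and the bivariant Cu-semigroup -/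

/-- The index set `ℚ ∩ (0,1)` for paths. -/
abbrev IQ : Type := {q : ℚ // 0 < q ∧ q < 1}

theorem IQ.exists_gt (l : IQ) : ∃ m : IQ, l.1 < m.1 := by
  refine ⟨⟨(l.1 + 1) / 2, ⟨by linarith [l.2.1, l.2.2], by linarith [l.2.2]⟩⟩, ?_⟩
  simp only
  linarith [l.2.2]

theorem IQ.exists_gt₂ (l m : IQ) : ∃ r : IQ, l.1 < r.1 ∧ m.1 < r.1 := by
  have h1 : l.1 ≤ max l.1 m.1 := le_max_left _ _
  have h2 : m.1 ≤ max l.1 m.1 := le_max_right _ _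
  have ht : max l.1 m.1 < 1 := max_lt l.2.2 m.2.2
  have ht0 : 0 < max l.1 m.1 := lt_of_lt_of_le l.2.1 h1
  refine ⟨⟨(max l.1 m.1 + 1) / 2, ⟨by linarith, by linarith⟩⟩, ?_, ?_⟩ <;>
    simp only <;> linarith

/-- A path of generalized Cu-morphisms: a `ℚ ∩ (0,1)`-indexed family which is increasing
with respect to the auxiliary relation `≺`. -/
structure CuPath (S T : Type*) [AddCommMonoid S] [PartialOrder S]
    [AddCommMonoid T] [PartialOrder T] where
  f : IQ → GenCuMor S T
  prec : ∀ l m : IQ, l.1 < m.1 → Prec (f l) (f m)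

namespace CuPath

variable {S T P : Type*} [AddCommMonoid S] [PartialOrder S] [AddCommMonoid T] [PartialOrder T]
  [AddCommMonoid P] [PartialOrder P]

theorem ext' {p q : CuPath S T} (h : p.f = q.f) : p = q := by
  cases p; cases q; cases h; rfl

end CuPath

/-- The preorder `f ≾ g` on paths. -/
def PathLE {S T : Type*} [AddCommMonoid S] [PartialOrder S] [AddCommMonoid T] [PartialOrder T]
    (p q : CuPath S T) : Prop :=
  ∀ l : IQ, ∃ m : IQ, Prec (p.f l) (q.f m)

/-- The equivalence relation on paths: `p ∼ q` iff `p ≾ q` and `q ≾ p`. -/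
def PathEquiv {S T : Type*} [AddCommMonoid S] [PartialOrder S] [AddCommMonoid T] [PartialOrder T]
    (p q : CuPath S T) : Prop :=
  PathLE p q ∧ PathLE q p

namespace PathLE

variable {S T : Type*} [AddCommMonoid S] [PartialOrder S] [AddCommMonoid T] [PartialOrder T]

theorem refl (p : CuPath S T) : PathLE p p := fun l =>
  let ⟨m, hm⟩ := IQ.exists_gt l
  ⟨m, p.prec l m hm⟩

theorem trans [CuSemigroup S] {p q r : CuPath S T} (h1 : PathLE p q) (h2 : PathLE q r) :
    PathLE p r := fun l =>
  let ⟨m, hm⟩ := h1 l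
  let ⟨n, hn⟩ := h2 m
  ⟨n, hm.trans hn⟩

end PathLE

instance CuPath.setoid (S T : Type*) [AddCommMonoid S] [PartialOrder S] [AddCommMonoid T]
    [PartialOrder T] [CuSemigroup S] : Setoid (CuPath S T) where
  r := PathEquiv
  iseqv :=
    { refl := fun p => ⟨PathLE.refl p, PathLE.refl p⟩
      symm := fun h => ⟨h.2, h.1⟩
      trans := fun h1 h2 => ⟨h1.1.trans h2.1, h2.2.trans h1.2⟩ }

/-- The bivariant Cu-semigroup `⟦S,T⟧`: equivalence classes of paths. -/
def BivCu (S T : Type*) [AddCommMonoid S] [PartialOrder S] [AddCommMonoid T] [PartialOrder T]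
    [CuSemigroup S] : Type _ :=
  Quotient (CuPath.setoid S T)

namespace BivCu

variable {S T P Q : Type*} [AddCommMonoid S] [PartialOrder S] [AddCommMonoid T] [PartialOrder T]
  [AddCommMonoid P] [PartialOrder P] [AddCommMonoid Q] [PartialOrder Q]

/-- Class of a path in the bivariant Cu-semigroup. -/
def mk [CuSemigroup S] (p : CuPath S T) : BivCu S T := Quotient.mk (CuPath.setoid S T) p

instance [CuSemigroup S] : PartialOrder (BivCu S T) where
  le := Quotient.lift₂ PathLE (by
    intro p q p' q' hp hq
    exact propext ⟨fun h => (hp.2.trans h).trans hq.1, fun h => (hp.1.trans h).trans hq.2⟩)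
  le_refl := by
    rintro ⟨p⟩
    exact PathLE.refl p
  le_trans := by
    rintro ⟨p⟩ ⟨q⟩ ⟨r⟩ h1 h2
    exact PathLE.trans h1 h2
  le_antisymm := by
    rintro ⟨p⟩ ⟨q⟩ h1 h2
    exact Quotient.sound ⟨h1, h2⟩

theorem mk_le_mk [CuSemigroup S] {p q : CuPath S T} : mk p ≤ mk q ↔ PathLE p q := Iff.rfl

end BivCu

/-- Pointwise addition of paths. -/
def CuPath.add {S T : Type*} [AddCommMonoid S] [PartialOrder S] [AddCommMonoid T]
    [PartialOrder T] [CuSemigroup T] (p q : CuPath S T) : CuPath S T where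
  f l := p.f l + q.f l
  prec l m h := (p.prec l m h).add (q.prec l m h)

/-- The zero path. -/
def CuPath.zero (S T : Type*) [AddCommMonoid S] [PartialOrder S] [AddCommMonoid T]
    [PartialOrder T] [CuSemigroup T] : CuPath S T where
  f _ := 0
  prec _ _ _ := fun _ _ _ => wayBelow_zero

theorem PathLE.add {S T : Type*} [AddCommMonoid S] [PartialOrder S] [AddCommMonoid T]
    [PartialOrder T] [CuSemigroup S] [CuSemigroup T] {p p' q q' : CuPath S T}
    (hp : PathLE p p') (hq : PathLE q q') : PathLE (p.add q) (p'.add q') := by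
  intro l
  obtain ⟨m1, h1⟩ := hp l
  obtain ⟨m2, h2⟩ := hq l
  obtain ⟨r, hr1, hr2⟩ := IQ.exists_gt₂ m1 m2
  exact ⟨r, (h1.trans (p'.prec m1 r hr1)).add (h2.trans (q'.prec m2 r hr2))⟩

theorem PathEquiv.add {S T : Type*} [AddCommMonoid S] [PartialOrder S] [AddCommMonoid T]
    [PartialOrder T] [CuSemigroup S] [CuSemigroup T] {p p' q q' : CuPath S T}
    (hp : PathEquiv p p') (hq : PathEquiv q q') : PathEquiv (p.add q) (p'.add q') :=
  ⟨PathLE.add hp.1 hq.1, PathLE.add hp.2 hq.2⟩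

namespace BivCu

variable {S T P : Type*} [AddCommMonoid S] [PartialOrder S] [AddCommMonoid T] [PartialOrder T]
  [AddCommMonoid P] [PartialOrder P]

instance [CuSemigroup S] [CuSemigroup T] : Add (BivCu S T) where
  add := Quotient.map₂ CuPath.add (fun _ _ hp _ _ hq => PathEquiv.add hp hq)

instance [CuSemigroup S] [CuSemigroup T] : Zero (BivCu S T) where
  zero := mk (CuPath.zero S T)

instance [CuSemigroup S] [CuSemigroup T] : AddCommMonoid (BivCu S T) where
  add := (· + ·)
  zero := 0
  add_assoc := by
    rintro ⟨p⟩ ⟨q⟩ ⟨r⟩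
    exact congrArg (Quotient.mk _) (CuPath.ext' (funext fun l => add_assoc _ _ _))
  zero_add := by
    rintro ⟨p⟩
    exact congrArg (Quotient.mk _) (CuPath.ext' (funext fun l => zero_add _))
  add_zero := by
    rintro ⟨p⟩
    exact congrArg (Quotient.mk _) (CuPath.ext' (funext fun l => add_zero _))
  add_comm := by
    rintro ⟨p⟩ ⟨q⟩
    exact congrArg (Quotient.mk _) (CuPath.ext' (funext fun l => add_comm _ _))
  nsmul := nsmulRec
  nsmul_zero := fun _ => rfl
  nsmul_succ := fun _ _ => rfl

theorem mk_add_mk [CuSemigroup S] [CuSemigroup T] (p q : CuPath S T) :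
    mk p + mk q = mk (p.add q) := rfl

end BivCu

/-- Composition of paths. -/
def CuPath.comp {S T P : Type*} [AddCommMonoid S] [PartialOrder S] [AddCommMonoid T]
    [PartialOrder T] [AddCommMonoid P] [PartialOrder P]
    (q : CuPath T P) (p : CuPath S T) : CuPath S P where
  f l := (q.f l).comp (p.f l)
  prec l m h := Prec.comp (p.prec l m h) (q.prec l m h)

theorem PathLE.comp {S T P : Type*} [AddCommMonoid S] [PartialOrder S] [AddCommMonoid T]
    [PartialOrder T] [AddCommMonoid P] [PartialOrder P] [CuSemigroup S] [CuSemigroup T]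
    {q q' : CuPath T P} {p p' : CuPath S T} (hq : PathLE q q') (hp : PathLE p p') :
    PathLE (q.comp p) (q'.comp p') := by
  intro l
  obtain ⟨m1, h1⟩ := hp l
  obtain ⟨m2, h2⟩ := hq l
  obtain ⟨r, hr1, hr2⟩ := IQ.exists_gt₂ m1 m2
  exact ⟨r, Prec.comp (h1.trans (p'.prec m1 r hr1)) (h2.trans (q'.prec m2 r hr2))⟩

theorem PathEquiv.comp {S T P : Type*} [AddCommMonoid S] [PartialOrder S] [AddCommMonoid T]
    [PartialOrder T] [AddCommMonoid P] [PartialOrder P] [CuSemigroup S] [CuSemigroup T]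
    {q q' : CuPath T P} {p p' : CuPath S T} (hq : PathEquiv q q') (hp : PathEquiv p p') :
    PathEquiv (q.comp p) (q'.comp p') :=
  ⟨PathLE.comp hq.1 hp.1, PathLE.comp hq.2 hp.2⟩

/-- The composition product on bivariant Cu-semigroups. -/
def BivCu.comp {S T P : Type*} [AddCommMonoid S] [PartialOrder S] [AddCommMonoid T]
    [PartialOrder T] [AddCommMonoid P] [PartialOrder P] [CuSemigroup S] [CuSemigroup T]
    (y : BivCu T P) (x : BivCu S T) : BivCu S P :=
  Quotient.map₂ CuPath.comp (fun _ _ hq _ _ hp => PathEquiv.comp hq hp) y x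

theorem BivCu.comp_mk_mk {S T P : Type*} [AddCommMonoid S] [PartialOrder S] [AddCommMonoid T]
    [PartialOrder T] [AddCommMonoid P] [PartialOrder P] [CuSemigroup S] [CuSemigroup T]
    (q : CuPath T P) (p : CuPath S T) :
    BivCu.comp (BivCu.mk q) (BivCu.mk p) = BivCu.mk (q.comp p) := rfl

/-- The constant path at the identity morphism. -/
def CuPath.id (S : Type*) [AddCommMonoid S] [PartialOrder S] : CuPath S S where
  f _ := GenCuMor.id S
  prec _ _ _ := fun _ _ ha => ha

/-- The class of the constant path at the identity: the unit of `⟦S,S⟧`. -/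
def BivCu.id (S : Type*) [AddCommMonoid S] [PartialOrder S] [CuSemigroup S] : BivCu S S :=
  BivCu.mk (CuPath.id S)

/-! ### Ideals, morphism predicates, bimorphisms, softness, elementary paths -/

/-- An ideal of a Cu-semigroup: a downward hereditary submonoid closed under
suprema of increasing sequences. -/
def IsCuIdeal {S : Type*} [AddCommMonoid S] [PartialOrder S] (J : Set S) : Prop :=
  (0 : S) ∈ J ∧ (∀ a b : S, a ∈ J → b ∈ J → a + b ∈ J) ∧
  (∀ a b : S, b ≤ a → a ∈ J → b ∈ J) ∧
  (∀ c : ℕ → S, Monotone c → (∀ n, c n ∈ J) → ∀ s : S, IsLUB (Set.range c) s → s ∈ J)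

/-- Predicate: `f` is (the function of) a generalized Cu-morphism. -/
def IsGenCuMorFun {S T : Type*} [AddCommMonoid S] [PartialOrder S] [AddCommMonoid T]
    [PartialOrder T] (f : S → T) : Prop :=
  f 0 = 0 ∧ (∀ a b : S, f (a + b) = f a + f b) ∧ Monotone f ∧
  ∀ (c : ℕ → S) (s : S), Monotone c → IsLUB (Set.range c) s →
    IsLUB (Set.range (fun n => f (c n))) (f s)

/-- Predicate: `f` is a Cu-morphism (generalized Cu-morphism preserving way-below). -/
def IsCuMorFun {S T : Type*} [AddCommMonoid S] [PartialOrder S] [AddCommMonoid T]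
    [PartialOrder T] (f : S → T) : Prop :=
  IsGenCuMorFun f ∧ ∀ a b : S, WayBelow a b → WayBelow (f a) (f b)

/-- Predicate: `φ` is a Cu-bimorphism. -/
def IsCuBimor {A B C : Type*} [AddCommMonoid A] [PartialOrder A] [AddCommMonoid B]
    [PartialOrder B] [AddCommMonoid C] [PartialOrder C] (φ : A → B → C) : Prop :=
  (∀ b : B, φ 0 b = 0) ∧ (∀ a : A, φ a 0 = 0) ∧
  (∀ (a a' : A) (b : B), φ (a + a') b = φ a b + φ a' b) ∧
  (∀ (a : A) (b b' : B), φ a (b + b') = φ a b + φ a b') ∧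
  (∀ (a a' : A) (b : B), a ≤ a' → φ a b ≤ φ a' b) ∧
  (∀ (a : A) (b b' : B), b ≤ b' → φ a b ≤ φ a b') ∧
  (∀ (c : ℕ → A) (d : ℕ → B) (s : A) (t : B), Monotone c → Monotone d →
    IsLUB (Set.range c) s → IsLUB (Set.range d) t →
    IsLUB (Set.range (fun n => φ (c n) (d n))) (φ s t)) ∧
  (∀ (a' a : A) (b' b : B), WayBelow a' a → WayBelow b' b → WayBelow (φ a' b') (φ a b))

/-- A path in `(R, ≪)`: a `ℚ ∩ (0,1)`-indexed family, increasing with respect to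
the way-below relation. -/
structure ElemPath (R : Type*) [Preorder R] where
  f : IQ → R
  prec : ∀ l m : IQ, l.1 < m.1 → WayBelow (f l) (f m)

/-- A soft element of a Cu-semigroup. -/
def IsSoft {S : Type*} [AddCommMonoid S] [PartialOrder S] (a : S) : Prop :=
  ∀ a' : S, WayBelow a' a → ∃ k : ℕ, (k + 1) • a' ≤ k • a

/-! ### Cu-semirings: the left regular representation -/

/-- `IsAddOrderIso f` : `f` is a bijective additive order-isomorphism. -/
def IsAddOrderIso {A B : Type*} [AddCommMonoid A] [PartialOrder A] [AddCommMonoid B]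
    [PartialOrder B] (f : A → B) : Prop :=
  Function.Bijective f ∧ f 0 = 0 ∧ (∀ a b : A, f (a + b) = f a + f b) ∧
  (∀ a b : A, a ≤ b ↔ f a ≤ f b)

/-- The graph of the left regular representation `π_R : R → ⟦R,R⟧` of a Cu-semiring
`(R, mul)` : `IsPiR mul r x` holds iff `x` is the class of the path of left
multiplications by a path in `(R,≪)` with endpoint `r`. -/
def IsPiR {R : Type*} [AddCommMonoid R] [PartialOrder R] [CuSemigroup R]
    (mul : R → R → R) (r : R) (x : BivCu R R) : Prop :=
  ∃ (g : ElemPath R) (P : CuPath R R),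
    IsLUB (Set.range g.f) r ∧ (∀ (l : IQ) (a : R), (P.f l).toFun a = mul (g.f l) a) ∧
    x = BivCu.mk P

/-! ### A cofinal sequence in `ℚ ∩ (0,1)` -/

namespace IQ

/-- The cofinal sequence `(n + 1) / (n + 2)` in `ℚ ∩ (0,1)`. -/
def cofinalSeq (n : ℕ) : IQ :=
  ⟨((n : ℚ) + 1) / (n + 2), by positivity, by
    rw [div_lt_one (by positivity)]; linarith⟩

theorem cofinalSeq_mono : Monotone cofinalSeq := by
  intro m n h
  have h' : (m : ℚ) ≤ n := by exact_mod_cast h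
  change ((m : ℚ) + 1) / (m + 2) ≤ ((n : ℚ) + 1) / (n + 2)
  rw [div_le_div_iff₀ (by positivity) (by positivity)]
  nlinarith

theorem exists_lt_cofinalSeq (l : IQ) : ∃ n, l < cofinalSeq n := by
  have hl : 0 < 1 - l.1 := by linarith [l.2.2]
  obtain ⟨n, hn⟩ := exists_nat_gt (1 / (1 - l.1))
  refine ⟨n, ?_⟩
  change l.1 < ((n : ℚ) + 1) / (n + 2)
  rw [div_lt_iff₀ hl] at hn
  rw [lt_div_iff₀ (by positivity)]
  nlinarith

/-- The increasing bijection `l ↦ l / (1 - l)` from `ℚ ∩ (0,1)` onto the positive rationals. -/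
def odds (l : IQ) : ℚ := l.1 / (1 - l.1)

theorem odds_nonneg (l : IQ) : 0 ≤ l.odds :=
  div_nonneg l.2.1.le (by linarith [l.2.2])

theorem odds_strictMono : StrictMono odds := by
  intro l m h
  have h' : l.1 < m.1 := h
  have hl : 0 < 1 - l.1 := by linarith [l.2.2]
  have hm : 0 < 1 - m.1 := by linarith [m.2.2]
  unfold odds
  rw [div_lt_div_iff₀ hl hm]
  nlinarith

theorem odds_cofinalSeq (n : ℕ) : (cofinalSeq n).odds = ((n + 1 : ℕ) : ℚ) := by
  have h : (n : ℚ) + 2 ≠ 0 := by positivity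
  have h' : 1 - ((n : ℚ) + 1) / (n + 2) = 1 / (n + 2) := by field_simp; ring
  change ((n : ℚ) + 1) / (n + 2) / (1 - ((n : ℚ) + 1) / (n + 2)) = _
  rw [h']
  push_cast
  field_simp

/-- The point `a + t (b - a)` of the segment from `a` to `b`. -/
def segment (a b : IQ) (t : ℚ) (hab : a.1 < b.1) (h0 : 0 ≤ t) (h1 : t < 1) : IQ :=
  ⟨a.1 + t * (b.1 - a.1), by nlinarith [a.2.1], by nlinarith [b.2.2]⟩

theorem isLUB_range_comp_cofinalSeq {S : Type*} [Preorder S] {f : IQ → S} (hf : Monotone f)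
    {v : S} : IsLUB (Set.range fun n => f (cofinalSeq n)) v ↔ IsLUB (Set.range f) v := by
  have h : upperBounds (Set.range fun n => f (cofinalSeq n)) = upperBounds (Set.range f) := by
    ext u
    constructor
    · rintro hu _ ⟨l, rfl⟩
      obtain ⟨n, hn⟩ := exists_lt_cofinalSeq l
      exact (hf hn.le).trans (hu ⟨n, rfl⟩)
    · rintro hu _ ⟨n, rfl⟩
      exact hu ⟨_, rfl⟩
  simp only [IsLUB, h]

end IQ

/-! ### Suprema of increasing sequences of path classes -/

section Paths

variable {S T : Type*} [AddCommMonoid S] [PartialOrder S] [AddCommMonoid T] [PartialOrder T]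
  [CuSemigroup S]

theorem Prec.le {f g : GenCuMor S T} (h : Prec f g) : f ≤ g := by
  intro a
  obtain ⟨c, hc, hlub⟩ := CuSemigroup.O2 a
  refine (f.map_sup' c a (monotone_nat_of_le_succ fun n => (hc n).le) hlub).2 ?_
  rintro _ ⟨n, rfl⟩
  exact (h _ _ (WayBelow.of_le_right (hc n) (hlub.1 ⟨n + 1, rfl⟩))).le

namespace CuPath

theorem monotone_f (p : CuPath S T) : Monotone p.f := by
  intro l m h
  rcases h.eq_or_lt with rfl | h
  · exact le_rfl
  · exact (p.prec l m h).le

theorem monotone_eval (p : CuPath S T) (a : S) : Monotone fun l => (p.f l).toFun a :=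
  fun _ _ h => p.monotone_f h a

theorem exists_isLUB_eval [CuSemigroup T] (p : CuPath S T) (a : S) :
    ∃ v, IsLUB (Set.range fun l => (p.f l).toFun a) v := by
  obtain ⟨v, hv⟩ := CuSemigroup.O1 (fun n => (p.f (IQ.cofinalSeq n)).toFun a)
    fun _ _ h => p.monotone_eval a (IQ.cofinalSeq_mono h)
  exact ⟨v, (IQ.isLUB_range_comp_cofinalSeq (p.monotone_eval a)).1 hv⟩

theorem prec_of_le (p : CuPath S T) {f : GenCuMor S T} {l m : IQ} (h : Prec f (p.f l))
    (hlm : l.1 ≤ m.1) : Prec f (p.f m) := by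
  rcases hlm.eq_or_lt with hlm | hlm
  · rwa [← Subtype.ext hlm]
  · exact h.trans (p.prec l m hlm)

/-- Choice of a segment of each path in a `≾`-increasing sequence, such that the end of each
segment, and the earlier paths up to that parameter, are `≺` the start of the next segment. -/
theorem exists_segments (p : ℕ → CuPath S T) (hp : ∀ k n, k ≤ n → PathLE (p k) (p n)) :
    ∃ a b : ℕ → IQ, (∀ n, (a n).1 < (b n).1) ∧ (∀ n, (IQ.cofinalSeq n).1 < (b n).1) ∧
      ∀ k n, k ≤ n → Prec ((p k).f (b n)) ((p (n + 1)).f (a (n + 1))) := by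
  have hA : ∀ n b, ∃ a, ∀ k, k ≤ n → Prec ((p k).f b) ((p (n + 1)).f a) := by
    intro n b
    have h : ∀ j, ∃ a, ∀ k, k ≤ n → k < j → Prec ((p k).f b) ((p (n + 1)).f a) := by
      intro j
      induction j with
      | zero => exact ⟨b, fun k _ hk => absurd hk (Nat.not_lt_zero k)⟩
      | succ j ih =>
        obtain ⟨a, ha⟩ := ih
        by_cases hj : j ≤ n
        · obtain ⟨m, hm⟩ := hp j (n + 1) (hj.trans n.le_succ) b
          obtain ⟨r, hr1, hr2⟩ := IQ.exists_gt₂ a m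
          refine ⟨r, fun k hk hkj => ?_⟩
          rcases Nat.lt_succ_iff_lt_or_eq.1 hkj with hkj | rfl
          · exact (p (n + 1)).prec_of_le (ha k hk hkj) hr1.le
          · exact (p (n + 1)).prec_of_le hm hr2.le
        · exact ⟨a, fun k hk hkj => ha k hk (by omega)⟩
    obtain ⟨a, ha⟩ := h (n + 1)
    exact ⟨a, fun k hk => ha k hk (Nat.lt_succ_of_le hk)⟩
  choose A hA using hA
  choose B hB₁ hB₂ using IQ.exists_gt₂
  let s : ℕ → IQ × IQ := fun n => Nat.rec
    (IQ.cofinalSeq 0, B (IQ.cofinalSeq 0) (IQ.cofinalSeq 0))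
    (fun n ab => (A n ab.2, B (A n ab.2) (IQ.cofinalSeq (n + 1)))) n
  refine ⟨fun n => (s n).1, fun n => (s n).2, fun n => ?_, fun n => ?_,
    fun k n hk => hA n (s n).2 k hk⟩
  · cases n <;> exact hB₁ _ _
  · cases n <;> exact hB₂ _ _

/-- A `≾`-increasing sequence of paths has an upper bound each of whose members is a member of
one of the given paths. -/
theorem exists_diagonal (p : ℕ → CuPath S T) (hp : ∀ k n, k ≤ n → PathLE (p k) (p n)) :
    ∃ q : CuPath S T, (∀ k, PathLE (p k) q) ∧ ∀ l, ∃ n m, q.f l = (p n).f m := by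
  obtain ⟨a, b, hab, hb, h⟩ := exists_segments p hp
  have h0 : ∀ l : IQ, 0 ≤ l.odds - ⌊l.odds⌋₊ := fun l =>
    sub_nonneg.2 (Nat.floor_le l.odds_nonneg)
  have h1 : ∀ l : IQ, l.odds - ⌊l.odds⌋₊ < 1 := fun l => by
    linarith [Nat.lt_floor_add_one l.odds]
  let σ : IQ → IQ := fun l =>
    IQ.segment (a ⌊l.odds⌋₊) (b ⌊l.odds⌋₊) _ (hab _) (h0 l) (h1 l)
  have hσ : ∀ l, (σ l).1 = (a ⌊l.odds⌋₊).1 +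
      (l.odds - ⌊l.odds⌋₊) * ((b ⌊l.odds⌋₊).1 - (a ⌊l.odds⌋₊).1) := fun l => rfl
  have ha_le : ∀ l, (a ⌊l.odds⌋₊).1 ≤ (σ l).1 := fun l => by
    rw [hσ]; nlinarith [h0 l, hab ⌊l.odds⌋₊]
  have hlt_b : ∀ l, (σ l).1 < (b ⌊l.odds⌋₊).1 := fun l => by
    rw [hσ]; nlinarith [h1 l, hab ⌊l.odds⌋₊]
  have hstep : ∀ m n, m < n → Prec ((p m).f (b m)) ((p n).f (a n)) := by
    intro m n hmn
    induction n, hmn using Nat.le_induction with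
    | base => exact h m m le_rfl
    | succ n _ ih => exact (ih.trans ((p n).prec _ _ (hab n))).trans (h n n le_rfl)
  let q : CuPath S T :=
    { f := fun l => (p ⌊l.odds⌋₊).f (σ l)
      prec := by
        intro l m hlm
        have hlt : l.odds < m.odds := IQ.odds_strictMono hlm
        rcases (Nat.floor_mono hlt.le).eq_or_lt with heq | hfl
        · have : (σ l).1 < (σ m).1 := by
            rw [hσ, hσ, ← heq]
            nlinarith [hab ⌊l.odds⌋₊]
          rw [← heq]
          exact (p _).prec _ _ this
        · exact (p _).prec_of_le
            (((p _).prec _ _ (hlt_b l)).trans (hstep _ _ hfl)) (ha_le m) }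
  refine ⟨q, fun k l => ?_, fun l => ⟨_, _, rfl⟩⟩
  obtain ⟨n, hn⟩ := IQ.exists_lt_cofinalSeq l
  have hfl : ⌊(IQ.cofinalSeq (max k n)).odds⌋₊ = max k n + 1 := by
    rw [IQ.odds_cofinalSeq, Nat.floor_natCast]
  have hl : l.1 < (b (max k n)).1 :=
    (lt_of_lt_of_le hn (IQ.cofinalSeq_mono (le_max_right k n))).trans (hb (max k n))
  have hk := ((p k).prec _ _ hl).trans (h k _ (le_max_left k n))
  rw [← hfl] at hk
  exact ⟨IQ.cofinalSeq (max k n), (p _).prec_of_le hk (ha_le _)⟩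

end CuPath

/-- Evaluation at a fixed element, `[(f_λ)_λ] ↦ sup_λ f_λ(a)`, is a well-defined generalized
Cu-morphism on `⟦S,T⟧`. -/
theorem BivCu.exists_eval [CuSemigroup T] (a : S) :
    ∃ eps : BivCu S T → T,
      (∀ p : CuPath S T, IsLUB (Set.range fun l => (p.f l).toFun a) (eps (BivCu.mk p))) ∧
      IsGenCuMorFun eps := by
  choose v hv using fun p : CuPath S T => p.exists_isLUB_eval a
  have hle : ∀ p q, PathLE p q → v p ≤ v q := by
    intro p q hpq
    refine (hv p).2 ?_
    rintro _ ⟨l, rfl⟩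
    obtain ⟨m, hm⟩ := hpq l
    exact (hm.le a).trans ((hv q).1 ⟨m, rfl⟩)
  let eps : BivCu S T → T :=
    Quotient.lift v fun p q h => le_antisymm (hle p q h.1) (hle q p h.2)
  have hmono : Monotone eps := by
    rintro ⟨p⟩ ⟨q⟩ h
    exact hle p q h
  refine ⟨eps, hv, ?_, ?_, hmono, ?_⟩
  · refine (hv (CuPath.zero S T)).unique ?_
    change IsLUB (Set.range fun _ : IQ => (0 : T)) 0
    have : Nonempty IQ := ⟨IQ.cofinalSeq 0⟩
    rw [Set.range_const]
    exact isLUB_singleton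
  · rintro ⟨p⟩ ⟨q⟩
    refine (hv (p.add q)).unique ?_
    rw [← IQ.isLUB_range_comp_cofinalSeq ((p.add q).monotone_eval a)]
    exact CuSemigroup.O4 _ _ _ _
      (fun _ _ h => p.monotone_eval a (IQ.cofinalSeq_mono h))
      (fun _ _ h => q.monotone_eval a (IQ.cofinalSeq_mono h))
      ((IQ.isLUB_range_comp_cofinalSeq (p.monotone_eval a)).2 (hv p))
      ((IQ.isLUB_range_comp_cofinalSeq (q.monotone_eval a)).2 (hv q))
  · intro c x hc hx
    choose p hp using fun n => Quotient.exists_rep (c n)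
    obtain ⟨q, hpq, hqp⟩ := CuPath.exists_diagonal p fun k n hkn => by
      rw [← BivCu.mk_le_mk]
      have := hc hkn
      rwa [← hp k, ← hp n] at this
    constructor
    · rintro _ ⟨n, rfl⟩
      exact hmono (hx.1 ⟨n, rfl⟩)
    · intro u hu
      have hxq : x ≤ BivCu.mk q := by
        refine hx.2 ?_
        rintro _ ⟨n, rfl⟩
        rw [← hp n]
        exact hpq n
      refine (hmono hxq).trans ((hv q).2 ?_)
      rintro _ ⟨l, rfl⟩
      obtain ⟨n, m, hnm⟩ := hqp l
      have hn : v (p n) ≤ u := by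
        have hcn : eps (c n) ≤ u := hu ⟨n, rfl⟩
        rwa [← hp n] at hcn
      simp only [hnm]
      exact ((hv (p n)).1 ⟨m, rfl⟩).trans hn

end Paths

/-- For a Cu-semiring `R`, the map `ε_R : ⟦R,R⟧ → R`,
`ε_R([(f_λ)_λ]) = sup_λ f_λ(1)`, is a well-defined generalized Cu-morphism satisfying
`ε_R ∘ π_R = id_R`. -/
theorem epsilon_retracts_pi
    (R : Type*) [AddCommMonoid R] [PartialOrder R] [CuSemigroup R]
    (mul : R → R → R) (one : R) (hbi : IsCuBimor mul)
    (hassoc : ∀ a b c : R, mul (mul a b) c = mul a (mul b c))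
    (hone : ∀ a : R, mul a one = a) (hone' : ∀ a : R, mul one a = a) :
    ∃ eps : BivCu R R → R,
      (∀ (p : CuPath R R) (v : R),
        IsLUB (Set.range (fun l => (p.f l).toFun one)) v → eps (BivCu.mk p) = v) ∧
      IsGenCuMorFun eps ∧
      (∀ (r : R) (x : BivCu R R), IsPiR mul r x → eps x = r) := by
  obtain ⟨eps, heps, hmor⟩ := BivCu.exists_eval (S := R) (T := R) one
  refine ⟨eps, fun p v hv => (heps p).unique hv, hmor, ?_⟩
  rintro r _ ⟨g, P, hg, hP, rfl⟩
  refine (heps P).unique ?_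
  simpa only [hP, hone] using hg
end

section
/- Let R be a Cu-semiring. Then π_R: R → ⟦R,R⟧ is a multiplicative order-embedding: for all r, s ∈ R one has π_R(r) ≤ π_R(s) if and only if r ≤ s, and π_R(rs) = π_R(r)∘π_R(s). Thus π_R identifies R with a sub-semiring of ⟦R,R⟧, which is unital when the unit of R is compact. -/
/-- A cofinal increasing sequence in `ℚ ∩ (0,1)`. -/
def IQ.seq (n : ℕ) : IQ :=
  ⟨1 - 1 / (n + 2), by
    have h : (0 : ℚ) < n + 2 := by positivity
    constructor
    · rw [sub_pos, div_lt_one h]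
      linarith [(Nat.cast_nonneg n : (0 : ℚ) ≤ n)]
    · have : (0 : ℚ) < 1 / (n + 2) := by positivity
      linarith⟩

theorem IQ.seq_lt_seq {m n : ℕ} (h : m < n) : (IQ.seq m).1 < (IQ.seq n).1 := by
  have h' : (m : ℚ) < n := by exact_mod_cast h
  have : (1 : ℚ) / (n + 2) < 1 / (m + 2) :=
    one_div_lt_one_div_of_lt (by positivity) (by linarith)
  simp only [IQ.seq]
  linarith

theorem IQ.exists_lt_seq (l : IQ) : ∃ n : ℕ, l.1 < (IQ.seq n).1 := by
  obtain ⟨n, hn⟩ := exists_nat_one_div_lt (sub_pos.2 l.2.2)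
  refine ⟨n, ?_⟩
  have : (1 : ℚ) / (n + 2) < 1 / (n + 1) :=
    one_div_lt_one_div_of_lt (by positivity) (by linarith)
  simp only [IQ.seq]
  linarith

namespace ElemPath

variable {R : Type*}

theorem monotone_seq [Preorder R] (g : ElemPath R) : Monotone fun n => g.f (IQ.seq n) :=
  monotone_nat_of_le_succ fun n => (g.prec _ _ (IQ.seq_lt_seq n.lt_succ_self)).le

theorem isLUB_seq_iff [Preorder R] (g : ElemPath R) {r : R} :
    IsLUB (Set.range fun n => g.f (IQ.seq n)) r ↔ IsLUB (Set.range g.f) r := by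
  have h : upperBounds (Set.range fun n => g.f (IQ.seq n)) = upperBounds (Set.range g.f) := by
    ext b
    constructor
    · rintro hb _ ⟨l, rfl⟩
      obtain ⟨n, hn⟩ := IQ.exists_lt_seq l
      exact (g.prec _ _ hn).le.trans (hb ⟨n, rfl⟩)
    · rintro hb _ ⟨n, rfl⟩
      exact hb ⟨_, rfl⟩
  rw [IsLUB, IsLUB, h]

theorem exists_wayBelow_of_wayBelow [Preorder R] (g : ElemPath R) {a r : R}
    (hr : IsLUB (Set.range g.f) r) (ha : WayBelow a r) : ∃ m : IQ, WayBelow a (g.f m) := by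
  obtain ⟨n, hn⟩ := ha _ g.monotone_seq r (g.isLUB_seq_iff.2 hr) le_rfl
  exact ⟨_, WayBelow.of_le_left hn (g.prec _ _ (IQ.seq_lt_seq n.lt_succ_self))⟩

end ElemPath

namespace IsPiR

variable {R : Type*} [AddCommMonoid R] [PartialOrder R] [CuSemigroup R]
  {mul : R → R → R} {r s : R} {x y : BivCu R R}

theorem mono (hbi : IsCuBimor mul) (hx : IsPiR mul r x) (hy : IsPiR mul s y) (hrs : r ≤ s) :
    x ≤ y := by
  obtain ⟨g, P, hg, hP, rfl⟩ := hx
  obtain ⟨h, Q, hh, hQ, rfl⟩ := hy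
  obtain ⟨-, -, -, -, -, -, -, hway⟩ := hbi
  refine BivCu.mk_le_mk.2 fun l => ?_
  obtain ⟨l', hl⟩ := IQ.exists_gt l
  have hs : WayBelow (g.f l) s := (g.prec l l' hl).of_le_right ((hg.1 ⟨l', rfl⟩).trans hrs)
  obtain ⟨m, hm⟩ := h.exists_wayBelow_of_wayBelow hh hs
  refine ⟨m, fun a' a ha => ?_⟩
  rw [hP, hQ]
  exact hway _ _ _ _ hm ha

theorem le_of_le {one : R} (hone : ∀ a : R, mul a one = a)
    (hx : IsPiR mul r x) (hy : IsPiR mul s y) (hxy : x ≤ y) : r ≤ s := by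
  obtain ⟨g, P, hg, hP, rfl⟩ := hx
  obtain ⟨h, Q, hh, hQ, rfl⟩ := hy
  obtain ⟨c, hc, hlub⟩ := CuSemigroup.O2 one
  have hmono : Monotone c := monotone_nat_of_le_succ fun n => (hc n).le
  refine hg.2 ?_
  rintro _ ⟨l, rfl⟩
  obtain ⟨m, hm⟩ := BivCu.mk_le_mk.1 hxy l
  have hsup := (P.f l).map_sup' c one hmono hlub
  rw [hP, hone] at hsup
  refine hsup.2 ?_
  rintro _ ⟨n, rfl⟩
  have hle := (hm (c n) one ((hc n).of_le_right (hlub.1 ⟨n + 1, rfl⟩))).le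
  rw [hQ, hone] at hle
  exact hle.trans (hh.1 ⟨m, rfl⟩)

theorem unique (hbi : IsCuBimor mul) (hx : IsPiR mul r x) (hy : IsPiR mul r y) : x = y :=
  le_antisymm (mono hbi hx hy le_rfl) (mono hbi hy hx le_rfl)

theorem comp (hbi : IsCuBimor mul) (hassoc : ∀ a b c : R, mul (mul a b) c = mul a (mul b c))
    (hx : IsPiR mul r x) (hy : IsPiR mul s y) : IsPiR mul (mul r s) (BivCu.comp x y) := by
  obtain ⟨g, P, hg, hP, rfl⟩ := hx
  obtain ⟨h, Q, hh, hQ, rfl⟩ := hy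
  obtain ⟨-, -, -, -, -, -, hsup, hway⟩ := hbi
  let k : ElemPath R :=
    ⟨fun l => mul (g.f l) (h.f l), fun l m hlm => hway _ _ _ _ (g.prec l m hlm) (h.prec l m hlm)⟩
  refine ⟨k, P.comp Q, k.isLUB_seq_iff.1 ?_, fun l a => ?_, BivCu.comp_mk_mk P Q⟩
  · exact hsup _ _ _ _ g.monotone_seq h.monotone_seq (g.isLUB_seq_iff.2 hg) (h.isLUB_seq_iff.2 hh)
  · show (P.f l).toFun ((Q.f l).toFun a) = mul (mul (g.f l) (h.f l)) a
    rw [hP, hQ, hassoc]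

theorem id_of_compact {one : R} (hone' : ∀ a : R, mul one a = a) (hc : WayBelow one one) :
    IsPiR mul one (BivCu.id R) := by
  refine ⟨⟨fun _ => one, fun _ _ _ => hc⟩, CuPath.id R, ?_, fun _ a => (hone' a).symm, rfl⟩
  have : Nonempty IQ := ⟨IQ.seq 0⟩
  rw [Set.range_const]
  exact isLUB_singleton

end IsPiR

/-- For a Cu-semiring `R`, the left regular representation
`π_R : R → ⟦R,R⟧` is a multiplicative order-embedding: `π_R(r) ≤ π_R(s)` iff `r ≤ s`, and
`π_R(rs) = π_R(r) ∘ π_R(s)`; it is moreover unital (sends the unit to `⟨id_R⟩`) when the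
unit of `R` is compact. -/
theorem pi_multiplicative_orderEmbedding
    (R : Type*) [AddCommMonoid R] [PartialOrder R] [CuSemigroup R]
    (mul : R → R → R) (one : R) (hbi : IsCuBimor mul)
    (hassoc : ∀ a b c : R, mul (mul a b) c = mul a (mul b c))
    (hone : ∀ a : R, mul a one = a) (hone' : ∀ a : R, mul one a = a) :
    (∀ (r s : R) (x y : BivCu R R), IsPiR mul r x → IsPiR mul s y → (x ≤ y ↔ r ≤ s)) ∧
    (∀ (r s : R) (x y z : BivCu R R), IsPiR mul r x → IsPiR mul s y →
      IsPiR mul (mul r s) z → z = BivCu.comp x y) ∧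
    (WayBelow one one → ∀ x : BivCu R R, IsPiR mul one x → x = BivCu.id R) := by
  refine ⟨fun r s x y hx hy => ⟨hx.le_of_le hone hy, hx.mono hbi hy⟩,
    fun r s x y z hx hy hz => hz.unique hbi (hx.comp hbi hassoc hy),
    fun hc x hx => hx.unique hbi (IsPiR.id_of_compact hone' hc)⟩
end

section
/- Let S and T be Cu-semigroups, let φ: S → T be a generalized Cu-morphism, and let a ∈ S be a soft element. Then φ(a) is a soft element of T. -/
theorem GenCuMor.map_nsmul {S T : Type*} [AddCommMonoid S] [PartialOrder S] [AddCommMonoid T]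
    [PartialOrder T] (φ : GenCuMor S T) (n : ℕ) (a : S) :
    φ.toFun (n • a) = n • φ.toFun a := by
  induction n with
  | zero => simp only [zero_nsmul, φ.map_zero']
  | succ n ih => rw [succ_nsmul, succ_nsmul, φ.map_add', ih]

theorem CuSemigroup.nsmul_le_nsmul {S : Type*} [AddCommMonoid S] [PartialOrder S] [CuSemigroup S]
    {a b : S} (h : a ≤ b) (n : ℕ) : n • a ≤ n • b := by
  induction n with
  | zero => simp only [zero_nsmul, le_refl]
  | succ n ih =>
    rw [succ_nsmul, succ_nsmul]
    exact CuSemigroup.add_le_add' _ _ _ _ ih h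

/-- If `x ≪ φ a`, then `x` lies below the image of some `a' ≪ a`. -/
theorem GenCuMor.exists_wayBelow_le {S T : Type*} [AddCommMonoid S] [PartialOrder S]
    [AddCommMonoid T] [PartialOrder T] [CuSemigroup S] (φ : GenCuMor S T) {x : T} {a : S}
    (h : WayBelow x (φ.toFun a)) : ∃ a' : S, WayBelow a' a ∧ x ≤ φ.toFun a' := by
  obtain ⟨c, hc, hlub⟩ := CuSemigroup.O2 a
  have hmono : Monotone c := monotone_nat_of_le_succ fun n => (hc n).le
  obtain ⟨n, hn⟩ := h _ (φ.mono'.comp hmono) _ (φ.map_sup' c a hmono hlub) le_rfl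
  exact ⟨c n, (hc n).of_le_right (hlub.1 (Set.mem_range_self (n + 1))), hn⟩

/-- A generalized Cu-morphism maps soft elements to soft elements. -/
theorem genCuMor_preserves_soft
    (S T : Type*) [AddCommMonoid S] [PartialOrder S] [AddCommMonoid T] [PartialOrder T]
    [CuSemigroup S] [CuSemigroup T] (φ : GenCuMor S T) (a : S) (ha : IsSoft a) :
    IsSoft (φ.toFun a) := by
  intro x hx
  obtain ⟨a', ha', hxa'⟩ := φ.exists_wayBelow_le hx
  obtain ⟨k, hk⟩ := ha a' ha'
  refine ⟨k, (CuSemigroup.nsmul_le_nsmul hxa' (k + 1)).trans ?_⟩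
  rw [← φ.map_nsmul, ← φ.map_nsmul]
  exact φ.mono' hk
end

section
/- Let R be a Cu-semiring. Then π_R: R → ⟦R,R⟧ is an isomorphism (a bijective, additive order-isomorphism) if and only if ε_R: ⟦R,R⟧ → R is an isomorphism; in that case each is the inverse of the other. -/
/-- The inverse of an additive order-isomorphism is an additive order-isomorphism. -/
theorem IsAddOrderIso.of_inverse {A B : Type*} [AddCommMonoid A] [PartialOrder A]
    [AddCommMonoid B] [PartialOrder B] {f : A → B} {g : B → A} (hf : IsAddOrderIso f)
    (hgf : Function.LeftInverse g f) (hfg : Function.RightInverse g f) : IsAddOrderIso g := by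
  obtain ⟨-, hzero, hadd, hle⟩ := hf
  refine ⟨⟨hfg.injective, hgf.surjective⟩, ?_, fun a b => ?_, fun a b => ?_⟩
  · rw [← hzero, hgf]
  · rw [← hgf (g a + g b), hadd, hfg, hfg]
  · rw [hle, hfg, hfg]

/-- For a Cu-semiring `R`, the map `π_R : R → ⟦R,R⟧` is an isomorphism
(a bijective additive order-isomorphism) if and only if `ε_R : ⟦R,R⟧ → R` is an
isomorphism; in that case each is the inverse of the other. -/
theorem pi_iso_iff_epsilon_iso
    (R : Type*) [AddCommMonoid R] [PartialOrder R] [CuSemigroup R]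
    (mul : R → R → R) (one : R) (hbi : IsCuBimor mul)
    (hassoc : ∀ a b c : R, mul (mul a b) c = mul a (mul b c))
    (hone : ∀ a : R, mul a one = a) (hone' : ∀ a : R, mul one a = a)
    (piR : R → BivCu R R) (eps : BivCu R R → R)
    (hpi : ∀ r : R, IsPiR mul r (piR r))
    (heps : ∀ (p : CuPath R R) (v : R),
      IsLUB (Set.range (fun l => (p.f l).toFun one)) v → eps (BivCu.mk p) = v) :
    (IsAddOrderIso piR ↔ IsAddOrderIso eps) ∧
    (IsAddOrderIso piR → (∀ r : R, eps (piR r) = r) ∧ (∀ x : BivCu R R, piR (eps x) = x)) := by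
  have hleft : Function.LeftInverse eps piR := by
    intro r
    obtain ⟨g, P, hg, hP, hx⟩ := hpi r
    rw [hx]
    refine heps P r ?_
    simpa only [hP, hone] using hg
  have hright : IsAddOrderIso piR → Function.RightInverse eps piR :=
    fun h => hleft.rightInverse_of_surjective h.1.2
  have hright' : IsAddOrderIso eps → Function.RightInverse eps piR :=
    fun h => hleft.rightInverse_of_injective h.1.1
  exact ⟨⟨fun h => h.of_inverse hleft (hright h), fun h => h.of_inverse (hright' h) hleft⟩,
    fun h => ⟨hleft, hright h⟩⟩
end
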